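/- Let m be a positive integer and q ∈ (1, m+1]. Then q ∈ B_2(m) if and only if there exist two sequences (c_i), (d_i) ∈ U'_q such that for all n = 0, 1, …, m−1, (n+1)/q + Σ_{i≥1} c_i q^{−(i+1)} = n/q + Σ_{i≥1} d_i q^{−(i+1)}. -/

import Mathlib

/-- A sequence of digits has a last nonzero digit. -/
def hasLastNonzero (c : ℕ → ℕ) : Prop := ∃ n, c n ≠ 0 ∧ ∀ i > n, c i = 0

/-- `c` (with `c i` the `(i+1)`-st digit) is a `q`-expansion of `x`
with respect to the digit set `Ω_m = {0,1,…,m}`. -/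
def isExpansion (m : ℕ) (q : ℝ) (x : ℝ) (c : ℕ → ℕ) : Prop :=
  (∀ i, c i ≤ m) ∧ x = ∑' i : ℕ, (c i : ℝ) / q ^ (i + 1)

/-- The set `U_q` of points of `I_q = [0, m/(q-1)]` with a unique `q`-expansion. -/
def Uq (m : ℕ) (q : ℝ) : Set ℝ :=
  {x | x ∈ Set.Icc 0 ((m : ℝ) / (q - 1)) ∧ ∃! c, isExpansion m q x c}

/-- The set `U'_q` of digit sequences that are unique `q`-expansions. -/
def Uq' (m : ℕ) (q : ℝ) : Set (ℕ → ℕ) :=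
  {c | isExpansion m q (∑' i : ℕ, (c i : ℝ) / q ^ (i + 1)) c ∧
       ∀ d, isExpansion m q (∑' i : ℕ, (c i : ℝ) / q ^ (i + 1)) d → d = c}

/-- `B_2(m)`: bases `q ∈ (1, m+1]` for which some `x ∈ I_q` has exactly two
different `q`-expansions. -/
def B2 (m : ℕ) : Set ℝ :=
  {q | q ∈ Set.Ioc 1 ((m : ℝ) + 1) ∧
    ∃ x ∈ Set.Icc (0 : ℝ) ((m : ℝ) / (q - 1)), ∃ a b : ℕ → ℕ,
      a ≠ b ∧ isExpansion m q x a ∧ isExpansion m q x b ∧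
      ∀ c, isExpansion m q x c → c = a ∨ c = b}

/-- Strict lexicographic order on digit sequences. -/
def lexLt (a b : ℕ → ℕ) : Prop := ∃ n, (∀ i < n, a i = b i) ∧ a n < b n

/-- Lexicographic order on digit sequences. -/
def lexLe (a b : ℕ → ℕ) : Prop := lexLt a b ∨ a = b

/-- `a` is the quasi-greedy `q`-expansion of `1`: the lexicographically largest
`q`-expansion of `1` without a last nonzero digit. -/
def isQuasiGreedy (m : ℕ) (q : ℝ) (a : ℕ → ℕ) : Prop :=
  isExpansion m q 1 a ∧ ¬ hasLastNonzero a ∧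
  ∀ b, isExpansion m q 1 b → ¬ hasLastNonzero b → lexLe b a

/-- `A'_q = {(c_i) ∈ U'_q : c_1 < α_1(q)}`. -/
def Aq' (m : ℕ) (q : ℝ) : Set (ℕ → ℕ) :=
  {c | c ∈ Uq' m q ∧ ∀ a, isQuasiGreedy m q a → c 0 < a 0}

/-- `f_{c,d}(t) = (m+1)/t + Σ_{i≥1} (c_i + d_i) t^{-(i+1)} - m/(t-1)`. -/
noncomputable def fcd (m : ℕ) (c d : ℕ → ℕ) (t : ℝ) : ℝ :=
  ((m : ℝ) + 1) / t + (∑' i : ℕ, ((c i : ℝ) + (d i : ℝ)) / t ^ (i + 2)) - (m : ℝ) / (t - 1)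

/-- `x = q_f(m)`: the largest real root of `q³-(k+2)q²+q-(k+1)=0` if `m = 2k+1`,
and of `q²-(k+1)q-k=0` if `m = 2k`. -/
def isQf (m : ℕ) (x : ℝ) : Prop :=
  (∃ k : ℕ, m = 2 * k + 1 ∧
    x ^ 3 - ((k : ℝ) + 2) * x ^ 2 + x - ((k : ℝ) + 1) = 0 ∧
    ∀ y : ℝ, y ^ 3 - ((k : ℝ) + 2) * y ^ 2 + y - ((k : ℝ) + 1) = 0 → y ≤ x) ∨
  (∃ k : ℕ, m = 2 * k ∧
    x ^ 2 - ((k : ℝ) + 1) * x - (k : ℝ) = 0 ∧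
    ∀ y : ℝ, y ^ 2 - ((k : ℝ) + 1) * y - (k : ℝ) = 0 → y ≤ x)

/-- A doubly infinite sequence: neither it nor its reflection has a last nonzero digit. -/
def doublyInfinite (m : ℕ) (c : ℕ → ℕ) : Prop :=
  ¬ hasLastNonzero c ∧ ¬ hasLastNonzero (fun i => m - c i)

/-- `V_q`: points of `I_q` with at most one doubly infinite `q`-expansion. -/
def Vq (m : ℕ) (q : ℝ) : Set ℝ :=
  {x | x ∈ Set.Icc 0 ((m : ℝ) / (q - 1)) ∧
    ∀ a b : ℕ → ℕ, isExpansion m q x a → isExpansion m q x b →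
      doublyInfinite m a → doublyInfinite m b → a = b}

/-- `U = {q ∈ (1, m+1] : 1 ∈ U_q}`. -/
def Uset (m : ℕ) : Set ℝ := {q | q ∈ Set.Ioc 1 ((m : ℝ) + 1) ∧ (1 : ℝ) ∈ Uq m q}

/-- `V = {q ∈ (1, m+1] : 1 ∈ V_q}`. -/
def Vset (m : ℕ) : Set ℝ := {q | q ∈ Set.Ioc 1 ((m : ℝ) + 1) ∧ (1 : ℝ) ∈ Vq m q}

/-- The generalized golden ratio `G(m)`. -/
noncomputable def Gratio (m : ℕ) : ℝ :=
  if m % 2 = 0 then ((m / 2 : ℕ) : ℝ) + 1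
  else (((m / 2 : ℕ) : ℝ) + 1 +
    Real.sqrt (((m / 2 : ℕ) : ℝ) ^ 2 + 6 * ((m / 2 : ℕ) : ℝ) + 5)) / 2

/-- The set of accumulation points of a set of reals. -/
def accPts (S : Set ℝ) : Set ℝ := {x | AccPt x (Filter.principal S)}

/-- Iterated accumulation-point sets `B_2^{(i)}(m)`. -/
def B2iter (m : ℕ) : ℕ → Set ℝ
  | 0 => B2 m
  | n + 1 => accPts (B2iter m n)

/-- Prepend a digit to a digit sequence. -/
def consDigit (k : ℕ) (c : ℕ → ℕ) : ℕ → ℕ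
  | 0 => k
  | i + 1 => c i

theorem consDigit_head_tail (c : ℕ → ℕ) : consDigit (c 0) (fun i => c (i + 1)) = c := by
  funext i; cases i <;> rfl

theorem tsum_digits_shift (q : ℝ) (c : ℕ → ℕ) :
    ∑' i : ℕ, (c i : ℝ) / q ^ (i + 2) = (∑' i : ℕ, (c i : ℝ) / q ^ (i + 1)) / q := by
  rw [← tsum_div_const]
  exact tsum_congr fun i => by rw [pow_succ q (i + 1), div_div]

section

variable {m : ℕ} {q : ℝ}

theorem hasSum_const_digits (hq : 1 < q) (a : ℝ) :
    HasSum (fun i : ℕ => a / q ^ (i + 1)) (a / (q - 1)) := by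
  have h0 : 0 < q := by linarith
  have h := (hasSum_geometric_of_lt_one (inv_nonneg.2 h0.le) (inv_lt_one_of_one_lt₀ hq)).mul_left
    (a / q)
  have h1 : q - 1 ≠ 0 := by linarith
  have e : a / q * (1 - q⁻¹)⁻¹ = a / (q - 1) := by
    rw [show 1 - q⁻¹ = (q - 1) / q by field_simp]
    field_simp
  rw [e] at h
  refine h.congr_fun ?_
  intro i
  rw [pow_succ, inv_pow]
  field_simp

theorem summable_digits (hq : 1 < q) {c : ℕ → ℕ} (hc : ∀ i, c i ≤ m) :
    Summable (fun i : ℕ => (c i : ℝ) / q ^ (i + 1)) := by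
  have h0 : 0 < q := by linarith
  refine Summable.of_nonneg_of_le (fun i => by positivity) (fun i => ?_)
    (hasSum_const_digits hq m).summable
  have : (c i : ℝ) ≤ m := by exact_mod_cast hc i
  gcongr

theorem isExpansion.mem_Icc (hq : 1 < q) {x : ℝ} {c : ℕ → ℕ} (h : isExpansion m q x c) :
    x ∈ Set.Icc (0 : ℝ) (m / (q - 1)) := by
  have h0 : 0 < q := by linarith
  rw [h.2]
  refine ⟨tsum_nonneg fun i => by positivity, ?_⟩
  rw [← (hasSum_const_digits hq m).tsum_eq]
  refine (summable_digits hq h.1).tsum_le_tsum (fun i => ?_) (hasSum_const_digits hq m).summable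
  have : (c i : ℝ) ≤ m := by exact_mod_cast h.1 i
  gcongr

theorem isExpansion_consDigit (hq : 1 < q) {x : ℝ} {k : ℕ} {c : ℕ → ℕ} :
    isExpansion m q x (consDigit k c) ↔ k ≤ m ∧ isExpansion m q (q * x - k) c := by
  have h0 : 0 < q := by linarith
  have key : (∀ i, consDigit k c i ≤ m) →
      ∑' i : ℕ, (consDigit k c i : ℝ) / q ^ (i + 1) =
        k / q + (∑' i : ℕ, (c i : ℝ) / q ^ (i + 1)) / q := by
    intro hb
    rw [(summable_digits hq hb).tsum_eq_zero_add, ← tsum_digits_shift]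
    simp [consDigit]
  have hb : (∀ i, consDigit k c i ≤ m) ↔ k ≤ m ∧ ∀ i, c i ≤ m :=
    ⟨fun h => ⟨h 0, fun i => h (i + 1)⟩, fun h i => by cases i; exacts [h.1, h.2 _]⟩
  unfold isExpansion
  constructor
  · rintro ⟨h1, h2⟩
    rw [key h1] at h2
    refine ⟨(hb.1 h1).1, (hb.1 h1).2, ?_⟩
    rw [h2]; field_simp; ring
  · rintro ⟨hk, h1, h2⟩
    refine ⟨hb.2 ⟨hk, h1⟩, ?_⟩
    rw [key (hb.2 ⟨hk, h1⟩), ← h2]; field_simp; ring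

theorem isExpansion_iff_head_tail (hq : 1 < q) {x : ℝ} {c : ℕ → ℕ} :
    isExpansion m q x c ↔ c 0 ≤ m ∧ isExpansion m q (q * x - c 0) (fun i => c (i + 1)) := by
  rw [← isExpansion_consDigit hq, consDigit_head_tail]

theorem mul_div_sub_one (hq : 1 < q) : q * ((m : ℝ) / (q - 1)) = m + m / (q - 1) := by
  have : q - 1 ≠ 0 := by linarith
  field_simp; ring

theorem exists_digit (hq : 1 < q) (hqm : q ≤ m + 1) {x : ℝ}
    (hx : x ∈ Set.Icc (0 : ℝ) (m / (q - 1))) :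
    ∃ k : ℕ, k ≤ m ∧ q * x - k ∈ Set.Icc (0 : ℝ) (m / (q - 1)) := by
  have hM : 1 ≤ (m : ℝ) / (q - 1) := by rw [le_div_iff₀ (by linarith)]; linarith
  have h0 : 0 ≤ q * x := mul_nonneg (by linarith) hx.1
  have h1 : q * x ≤ m + m / (q - 1) := by
    rw [← mul_div_sub_one hq]; exact mul_le_mul_of_nonneg_left hx.2 (by linarith)
  rcases le_total (q * x) m with h | h
  · refine ⟨⌊q * x⌋₊, Nat.floor_le_of_le h, ?_, ?_⟩
    · linarith [Nat.floor_le h0]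
    · linarith [Nat.lt_floor_add_one (q * x)]
  · exact ⟨m, le_rfl, by linarith, by linarith⟩

theorem exists_isExpansion (hq : 1 < q) (hqm : q ≤ m + 1) {x : ℝ}
    (hx : x ∈ Set.Icc (0 : ℝ) (m / (q - 1))) : ∃ c, isExpansion m q x c := by
  have h0 : 0 < q := by linarith
  choose! f hfm hf using fun y (hy : y ∈ Set.Icc (0 : ℝ) (m / (q - 1))) => exists_digit hq hqm hy
  let r : ℕ → ℝ := fun n => Nat.rec x (fun _ y => q * y - f y) n
  have hr : ∀ n, r n ∈ Set.Icc (0 : ℝ) (m / (q - 1)) := by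
    intro n
    induction n with
    | zero => exact hx
    | succ n ih => exact hf _ ih
  have hrs : ∀ n, r (n + 1) = q * r n - f (r n) := fun n => rfl
  have hb : ∀ i, f (r i) ≤ m := fun i => hfm _ (hr i)
  have hpart : ∀ n, ∑ i ∈ Finset.range n, (f (r i) : ℝ) / q ^ (i + 1) = x - r n / q ^ n := by
    intro n
    induction n with
    | zero => simp [r]
    | succ n ih =>
      rw [Finset.sum_range_succ, ih, hrs, pow_succ]
      field_simp; ring
  have hlim : Filter.Tendsto (fun n => r n / q ^ n) Filter.atTop (nhds 0) := by
    have ht : Filter.Tendsto (fun n : ℕ => (m : ℝ) / (q - 1) / q ^ n) Filter.atTop (nhds 0) :=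
      (tendsto_pow_atTop_atTop_of_one_lt hq).const_div_atTop _
    refine squeeze_zero (fun n => div_nonneg (hr n).1 (by positivity)) (fun n => ?_) ht
    have := (hr n).2
    gcongr
  refine ⟨fun i => f (r i), hb, ?_⟩
  refine tendsto_nhds_unique ?_ (summable_digits hq hb).hasSum.tendsto_sum_nat
  simp only [hpart]
  simpa using hlim.const_sub x

theorem exists_two_isExpansion (hq : 1 < q) (hqm : q ≤ m + 1) {x : ℝ} (h1 : 1 ≤ x)
    (h2 : x + 1 ≤ m / (q - 1)) :
    ∃ c d, c ≠ d ∧ isExpansion m q x c ∧ isExpansion m q x d := by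
  have hM := mul_div_sub_one (m := m) hq
  set M : ℝ := m / (q - 1)
  obtain ⟨k, hk, hk0, hk1⟩ : ∃ k : ℕ, k + 1 ≤ m ∧ (k : ℝ) + 1 ≤ q * x ∧ q * x ≤ k + M := by
    have hm : 1 ≤ m := by
      rcases Nat.eq_zero_or_pos m with rfl | h
      · simp at hqm; linarith
      · exact h
    have hqx : 1 < q * x := by nlinarith
    have hqx' : q * x < m - 1 + M := by nlinarith
    rcases le_total (m : ℝ) (q * x) with h | h
    · refine ⟨m - 1, by omega, ?_, ?_⟩ <;> push_cast [hm] <;> linarith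
    · have hf : 1 ≤ ⌊q * x⌋₊ := Nat.le_floor (by simpa using hqx.le)
      have hfm : ⌊q * x⌋₊ ≤ m := Nat.floor_le_of_le h
      have hf1 := Nat.floor_le (show 0 ≤ q * x by linarith)
      have hf2 := Nat.lt_floor_add_one (q * x)
      refine ⟨⌊q * x⌋₊ - 1, by omega, ?_, ?_⟩ <;> push_cast [hf] <;> linarith
  obtain ⟨c, hc⟩ := exists_isExpansion hq hqm (x := q * x - k) ⟨by linarith, by linarith⟩
  obtain ⟨d, hd⟩ := exists_isExpansion hq hqm (x := q * x - (k + 1 : ℕ))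
    ⟨by push_cast; linarith, by push_cast; linarith⟩
  refine ⟨consDigit k c, consDigit (k + 1) d, fun h => ?_,
    (isExpansion_consDigit hq).2 ⟨by omega, hc⟩, (isExpansion_consDigit hq).2 ⟨hk, hd⟩⟩
  have := congrFun h 0
  simp [consDigit] at this

theorem isExpansion.mem_Uq' {x : ℝ} {c : ℕ → ℕ} (h : isExpansion m q x c)
    (hu : ∀ d, isExpansion m q x d → d = c) : c ∈ Uq' m q :=
  ⟨h.2 ▸ h, h.2 ▸ hu⟩

/-- Two expansions that are the only ones and differ in the first digit have uniquely
expanding tails, whose values differ by one. -/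
theorem exists_Uq'_of_head_lt (hq : 1 < q) (hqm : q ≤ m + 1) {x : ℝ} {a b : ℕ → ℕ}
    (ha : isExpansion m q x a) (hb : isExpansion m q x b)
    (hab : ∀ c, isExpansion m q x c → c = a ∨ c = b) (hlt : b 0 < a 0) :
    ∃ c ∈ Uq' m q, ∃ d ∈ Uq' m q,
      1 + ∑' i : ℕ, (c i : ℝ) / q ^ (i + 1) = ∑' i : ℕ, (d i : ℝ) / q ^ (i + 1) := by
  obtain ⟨ha0, ha'⟩ := (isExpansion_iff_head_tail hq).1 ha
  obtain ⟨hb0, hb'⟩ := (isExpansion_iff_head_tail hq).1 hb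
  have hlt' : (b 0 : ℝ) + 1 ≤ a 0 := by exact_mod_cast hlt
  have hsucc : a 0 = b 0 + 1 := by
    obtain ⟨e, he⟩ := exists_isExpansion hq hqm (x := q * x - (b 0 + 1 : ℕ))
      ⟨by push_cast; linarith [(ha'.mem_Icc hq).1], by push_cast; linarith [(hb'.mem_Icc hq).2]⟩
    have he' := (isExpansion_consDigit hq).2 ⟨show b 0 + 1 ≤ m by omega, he⟩
    rcases hab _ he' with h | h
    · exact (congrFun h 0).symm
    · exact absurd (congrFun h 0) (by simp [consDigit])
  refine ⟨_, ha'.mem_Uq' fun d hd => ?_, _, hb'.mem_Uq' fun d hd => ?_, ?_⟩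
  · rcases hab _ ((isExpansion_consDigit hq).2 ⟨ha0, hd⟩) with h | h
    · exact funext fun i => congrFun h (i + 1)
    · exact absurd (congrFun h 0) hlt.ne'
  · rcases hab _ ((isExpansion_consDigit hq).2 ⟨hb0, hd⟩) with h | h
    · exact absurd (congrFun h 0) hlt.ne
    · exact funext fun i => congrFun h (i + 1)
  · rw [← ha'.2, ← hb'.2, hsucc]; push_cast; ring

theorem exists_Uq'_of_exactly_two (hq : 1 < q) (hqm : q ≤ m + 1) (n : ℕ) :
    ∀ {x : ℝ} {a b : ℕ → ℕ}, isExpansion m q x a → isExpansion m q x b →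
      (∀ c, isExpansion m q x c → c = a ∨ c = b) → a n ≠ b n →
      ∃ c ∈ Uq' m q, ∃ d ∈ Uq' m q,
        1 + ∑' i : ℕ, (c i : ℝ) / q ^ (i + 1) = ∑' i : ℕ, (d i : ℝ) / q ^ (i + 1) := by
  induction n with
  | zero =>
    intro x a b ha hb hab hne
    rcases hne.lt_or_gt with h | h
    · exact exists_Uq'_of_head_lt hq hqm hb ha (fun c hc => (hab c hc).symm) h
    · exact exists_Uq'_of_head_lt hq hqm ha hb hab h
  | succ n ih =>
    intro x a b ha hb hab hne
    rcases lt_trichotomy (a 0) (b 0) with h | h | h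
    · exact exists_Uq'_of_head_lt hq hqm hb ha (fun c hc => (hab c hc).symm) h
    · obtain ⟨ha0, ha'⟩ := (isExpansion_iff_head_tail hq).1 ha
      obtain ⟨-, hb'⟩ := (isExpansion_iff_head_tail hq).1 hb
      rw [← h] at hb'
      refine ih ha' hb' (fun c hc => ?_) hne
      exact (hab _ ((isExpansion_consDigit hq).2 ⟨ha0, hc⟩)).imp
        (fun h => funext fun i => congrFun h (i + 1)) (fun h => funext fun i => congrFun h (i + 1))
    · exact exists_Uq'_of_head_lt hq hqm ha hb hab h

theorem mem_B2_of_Uq' (hm : 0 < m) (hq : q ∈ Set.Ioc 1 ((m : ℝ) + 1)) {c d : ℕ → ℕ}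
    (hc : c ∈ Uq' m q) (hd : d ∈ Uq' m q)
    (h : 1 + ∑' i : ℕ, (c i : ℝ) / q ^ (i + 1) = ∑' i : ℕ, (d i : ℝ) / q ^ (i + 1)) :
    q ∈ B2 m := by
  obtain ⟨hq1, hqm⟩ := hq
  have h0 : q ≠ 0 := by linarith
  obtain ⟨hc, hcu⟩ := hc
  obtain ⟨hd, hdu⟩ := hd
  rw [← h] at hd hdu
  set C : ℝ := ∑' i : ℕ, (c i : ℝ) / q ^ (i + 1)
  have hC : C < 1 := by
    by_contra! hC
    obtain ⟨e, f, hne, he, hf⟩ := exists_two_isExpansion hq1 hqm hC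
      (by linarith [(hd.mem_Icc hq1).2])
    exact hne ((hcu e he).trans (hcu f hf).symm)
  have hx : q * ((1 + C) / q) = 1 + C := by field_simp
  have h1 : isExpansion m q ((1 + C) / q) (consDigit 1 c) :=
    (isExpansion_consDigit hq1).2 ⟨hm, by simpa [hx] using hc⟩
  have h2 : isExpansion m q ((1 + C) / q) (consDigit 0 d) :=
    (isExpansion_consDigit hq1).2 ⟨hm.le, by simpa [hx] using hd⟩
  refine ⟨⟨hq1, hqm⟩, _, h1.mem_Icc hq1, _, _, fun e => ?_, h1, h2, fun e he => ?_⟩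
  · exact one_ne_zero (congrFun e 0)
  · obtain ⟨-, he'⟩ := (isExpansion_iff_head_tail hq1).1 he
    rw [hx] at he'
    have hlt : e 0 < 2 := by
      have := (he'.mem_Icc hq1).1
      have : (e 0 : ℝ) < 2 := by linarith
      exact_mod_cast this
    rw [← consDigit_head_tail e]
    obtain h | h : e 0 = 0 ∨ e 0 = 1 := by omega
    · rw [h] at he' ⊢
      exact Or.inr (congrArg _ (hdu _ (by simpa using he')))
    · rw [h] at he' ⊢
      exact Or.inl (congrArg _ (hcu _ (by simpa using he')))

end

/-- `q ∈ B_2(m)` iff there are `(c_i), (d_i) ∈ U'_q` with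
`((n+1)c)_q = (nd)_q` for all `n = 0, …, m-1`. -/
theorem stmt3 (m : ℕ) (hm : 0 < m) (q : ℝ) (hq : q ∈ Set.Ioc 1 ((m : ℝ) + 1)) :
    q ∈ B2 m ↔ ∃ c ∈ Uq' m q, ∃ d ∈ Uq' m q, ∀ n : ℕ, n < m →
      ((n : ℝ) + 1) / q + ∑' i : ℕ, (c i : ℝ) / q ^ (i + 2)
        = (n : ℝ) / q + ∑' i : ℕ, (d i : ℝ) / q ^ (i + 2) := by
  have h0 : q ≠ 0 := by linarith [hq.1]
  constructor
  · rintro ⟨-, x, -, a, b, hne, ha, hb, hab⟩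
    obtain ⟨n, hn⟩ := Function.ne_iff.1 hne
    obtain ⟨c, hc, d, hd, h⟩ := exists_Uq'_of_exactly_two hq.1 hq.2 n ha hb hab hn
    refine ⟨c, hc, d, hd, fun k _ => ?_⟩
    rw [tsum_digits_shift, tsum_digits_shift, ← h]
    ring
  · rintro ⟨c, hc, d, hd, h⟩
    refine mem_B2_of_Uq' hm hq hc hd ?_
    have := h 0 hm
    rw [tsum_digits_shift, tsum_digits_shift] at this
    field_simp at this
    simpa using this
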